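/- If n ≥ 1, then every componentwise pointed n-coboundary of G with coefficients in M is the differential of a componentwise pointed (n−1)-cochain. That is, B^n_cpt(G,M) = (C^{n−1}_cpt(G,M))∂. -/

import Mathlib

/-- The inhomogeneous group cohomology differential (tuples `(g_n, …, g_0)` encoded as
`f : Fin (n+1) → G` with `f j = g_j`). -/
def gdiff {G M : Type*} [Group G] [AddCommGroup M] [DistribMulAction G M] {n : ℕ}
    (c : (Fin n → G) → M) : (Fin (n + 1) → G) → M :=
  fun f =>
    c (fun i => f i.succ)
      + ∑ k : Fin n, ((-1 : ℤ) ^ (k.1 + 1)) •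
          c (fun j => if j.1 < k.1 then f j.castSucc
              else if j.1 = k.1 then f k.succ * f k.castSucc
              else f j.succ)
      + ((-1 : ℤ) ^ (n + 1)) • (f (Fin.last n) • c (fun i => f i.castSucc))

/-- A cochain is `k`-pointed if it vanishes whenever one of its arguments
`g_0, …, g_{k-1}` equals `1`. -/
def IsKPointed {G M : Type*} [Group G] [Zero M] {n : ℕ} (k : ℕ)
    (c : (Fin n → G) → M) : Prop :=
  ∀ f : Fin n → G, (∃ j : Fin n, j.1 < k ∧ f j = 1) → c f = 0

/-- A cochain is componentwise pointed if it vanishes whenever one of its arguments is `1`. -/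
def IsCptPointed {G M : Type*} [Group G] [Zero M] {n : ℕ}
    (c : (Fin n → G) → M) : Prop :=
  ∀ f : Fin n → G, (∃ j : Fin n, f j = 1) → c f = 0

/-- extension of a tuple by `1` -/
def extT {G : Type*} [Group G] {n : ℕ} (f : Fin n → G) (j : ℕ) : G :=
  if h : j < n then f ⟨j, h⟩ else 1

theorem extT_mk {G : Type*} [Group G] {n : ℕ} (φ : ℕ → G) (j : ℕ) :
    extT (fun i : Fin n => φ i.1) j = if j < n then φ j else 1 := by
  unfold extT; split_ifs <;> rfl

theorem extT_fin {G : Type*} [Group G] {n : ℕ} (f : Fin n → G) (j : Fin n) :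
    f j = extT f j.1 := by
  simp [extT]

def faceN {G : Type*} [Group G] (i : ℕ) (f : ℕ → G) (j : ℕ) : G :=
  if j + 1 < i then f j else if j + 1 = i then f (j+1) * f j else f (j + 1)

def faceT {G : Type*} [Group G] {n : ℕ} (i : ℕ) (f : Fin (n+1) → G) : Fin n → G :=
  fun j => faceN i (extT f) j.1

def insN {G : Type*} [Group G] (k : ℕ) (f : ℕ → G) (j : ℕ) : G :=
  if j < k then f j else if j = k then 1 else f (j - 1)

def insT {G : Type*} [Group G] {n : ℕ} (k : ℕ) (f : Fin n → G) : Fin (n+1) → G :=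
  fun j => insN k (extT f) j.1

def delN {G : Type*} [Group G] (k : ℕ) (f : ℕ → G) (j : ℕ) : G :=
  if j < k then f j else f (j + 1)

def delT {G : Type*} [Group G] {n : ℕ} (k : ℕ) (f : Fin (n+1) → G) : Fin n → G :=
  fun j => delN k (extT f) j.1

theorem ext_faceT {G : Type*} [Group G] {n : ℕ} (i : ℕ) (f : Fin (n+1) → G) (j : ℕ) :
    extT (faceT i f) j = if j < n then faceN i (extT f) j else 1 := extT_mk _ _
theorem ext_insT {G : Type*} [Group G] {n : ℕ} (i : ℕ) (f : Fin n → G) (j : ℕ) :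
    extT (insT i f) j = if j < n+1 then insN i (extT f) j else 1 := extT_mk _ _
theorem ext_delT {G : Type*} [Group G] {n : ℕ} (i : ℕ) (f : Fin (n+1) → G) (j : ℕ) :
    extT (delT i f) j = if j < n then delN i (extT f) j else 1 := extT_mk _ _

def scalT {G : Type*} [Group G] {n : ℕ} (i : ℕ) (f : Fin (n+1) → G) : G :=
  if i = n + 1 then extT f n else 1

theorem tup_ext {G : Type*} [Group G] {n : ℕ} {f g : Fin n → G}
    (h : ∀ j, j < n → extT f j = extT g j) : f = g := by
  funext j
  rw [extT_fin f, extT_fin g]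
  exact h _ j.2

def DD {G M : Type*} [Group G] [AddCommGroup M] [DistribMulAction G M] {n : ℕ}
    (i : ℕ) (c : (Fin n → G) → M) : (Fin (n + 1) → G) → M :=
  fun f => scalT i f • c (faceT i f)

theorem gdiff_eq {G M : Type*} [Group G] [AddCommGroup M] [DistribMulAction G M] {n : ℕ}
    (c : (Fin n → G) → M) (f : Fin (n + 1) → G) :
    gdiff c f = ∑ i ∈ Finset.range (n + 2), ((-1 : ℤ) ^ i) • DD i c f := by
  rw [Finset.sum_range_succ, Finset.sum_range_succ', Finset.sum_range]
  unfold gdiff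
  rw [add_comm (c _)]
  congr 1
  · congr 1
    · refine Finset.sum_congr rfl fun k _ => ?_
      have hk := k.2
      simp only [DD, scalT]
      rw [if_neg (by omega), one_smul]
      congr 2
      funext j
      have hj := j.2
      simp only [faceT, faceN, extT_fin f, Fin.val_succ, Fin.val_castSucc]
      grind
    · simp only [DD, scalT]
      rw [if_neg (by omega), one_smul, pow_zero, one_smul]
      congr 1
      funext j
      simp [faceT, faceN, extT_fin f]
  · simp only [DD, scalT]
    rw [if_pos trivial]
    congr 2
    · rw [extT_fin f]; rfl
    · congr 1
      funext j
      have hj := j.2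
      simp [faceT, faceN, extT_fin f]

theorem DD_comm {G M : Type*} [Group G] [AddCommGroup M] [DistribMulAction G M] {n : ℕ}
    (c : (Fin n → G) → M) (i j : ℕ) (hij : i < j) (hj : j ≤ n + 2) :
    DD j (DD i c) = DD i (DD (j-1) c) := by
  funext f
  simp only [DD, smul_smul]
  congr 1
  · simp only [scalT, ext_faceT, faceN]
    grind
  · congr 1
    apply tup_ext
    intro l hl
    simp only [ext_faceT, faceN]
    grind [mul_assoc]

theorem alt_sum {M : Type*} [AddCommGroup M] (a : ℕ → ℕ → M) (N : ℕ)
    (h : ∀ i j, i < j → j ≤ N → a j i = a i (j-1)) :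
    ∑ j ∈ Finset.range (N+1), ∑ i ∈ Finset.range N, ((-1:ℤ)^j * (-1)^i) • a j i = 0 := by
  induction N with
  | zero => simp
  | succ N ih =>
    have ih := ih fun i j h1 h2 => h i j h1 (by omega)
    rw [Finset.sum_range_succ]
    have e : ∑ j ∈ Finset.range (N+1), ∑ i ∈ Finset.range (N+1), ((-1:ℤ)^j * (-1)^i) • a j i
        = ∑ j ∈ Finset.range (N+1), (∑ i ∈ Finset.range N, ((-1:ℤ)^j * (-1)^i) • a j i
          + ((-1:ℤ)^j * (-1)^N) • a j N) :=
      Finset.sum_congr rfl fun j _ => Finset.sum_range_succ _ N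
    rw [e, Finset.sum_add_distrib, ih, zero_add, ← Finset.sum_add_distrib]
    refine Finset.sum_eq_zero fun i hi => ?_
    rw [Finset.mem_range] at hi
    rw [h i (N+1) hi le_rfl, Nat.add_sub_cancel, ← add_smul]
    rw [show ((-1:ℤ)^i * (-1)^N + (-1)^(N+1) * (-1)^i) = 0 by ring, zero_smul]

theorem DD_sum {G M : Type*} [Group G] [AddCommGroup M] [DistribMulAction G M] {n : ℕ}
    (c : (Fin n → G) → M) (j : ℕ) (f : Fin (n + 2) → G) :
    DD j (gdiff c) f = ∑ i ∈ Finset.range (n + 2), ((-1 : ℤ) ^ i) • DD j (DD i c) f := by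
  conv_lhs => unfold DD
  rw [gdiff_eq, Finset.smul_sum]
  refine Finset.sum_congr rfl fun i _ => ?_
  rw [smul_comm]
  rfl

theorem gdiff_gdiff {G M : Type*} [Group G] [AddCommGroup M] [DistribMulAction G M] {n : ℕ}
    (c : (Fin n → G) → M) : gdiff (gdiff c) = 0 := by
  funext f
  rw [gdiff_eq]
  simp_rw [DD_sum, Finset.smul_sum, smul_smul]
  exact alt_sum (fun j i => DD j (DD i c) f) (n+2) fun i j h1 h2 => by
    simp only [DD_comm c i j h1 h2]

theorem gdiff_sub_smul {G M : Type*} [Group G] [AddCommGroup M] [DistribMulAction G M] {n : ℕ}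
    (c d : (Fin n → G) → M) (z : ℤ) (f) :
    gdiff (fun g => c g - z • d g) f = gdiff c f - z • gdiff d f := by
  simp only [gdiff_eq, Finset.smul_sum, ← Finset.sum_sub_distrib]
  refine Finset.sum_congr rfl fun i _ => ?_
  simp only [DD, smul_sub]
  rw [smul_comm _ z, smul_comm _ z]

/-- pointed at position `j` -/
def PtAt {G M : Type*} [Group G] [AddCommGroup M] {n : ℕ} (j : ℕ)
    (c : (Fin n → G) → M) : Prop :=
  ∀ f : Fin n → G, j < n → extT f j = 1 → c f = 0

theorem DD_lt {G M : Type*} [Group G] [AddCommGroup M] [DistribMulAction G M] {n : ℕ}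
    (c : (Fin n → G) → M) (i j : ℕ) (hij : i < j) (h : PtAt (j-1) c) : PtAt j (DD i c) := by
  intro f hj hf
  rw [DD, h, smul_zero]
  · omega
  · simp only [ext_faceT, faceN]
    grind

theorem DD_gt {G M : Type*} [Group G] [AddCommGroup M] [DistribMulAction G M] {n : ℕ}
    (c : (Fin n → G) → M) (i j : ℕ) (hij : j + 1 < i) (hi : i ≤ n + 1)
    (h : PtAt j c) : PtAt j (DD i c) := by
  intro f hj hf
  rw [DD, h, smul_zero]
  · omega
  · simp only [ext_faceT, faceN]
    grind

theorem DD_eq {G M : Type*} [Group G] [AddCommGroup M] [DistribMulAction G M] {n : ℕ}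
    (c : (Fin n → G) → M) (i j : ℕ) (hij : i = j ∨ i = j + 1) (hj : j ≤ n)
    (f : Fin (n+1) → G) (hf : extT f j = 1) : DD i c f = c (delT j f) := by
  have h1 : scalT i f = 1 := by
    unfold scalT
    grind
  have h2 : faceT i f = delT j f := by
    apply tup_ext
    intro l hl
    simp only [ext_faceT, ext_delT, faceN, delN]
    grind [mul_one, one_mul]
  rw [DD, h1, h2, one_smul]

def SS {G M : Type*} [Group G] {n : ℕ} (k : ℕ) (c : (Fin (n+1) → G) → M) : (Fin n → G) → M :=
  fun g => c (insT k g)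

theorem DD_ins {G M : Type*} [Group G] [AddCommGroup M] [DistribMulAction G M] {n : ℕ}
    (c : (Fin (n+1) → G) → M) (i k : ℕ) (hi : k + 1 ≤ i) (hi' : i ≤ n + 1)
    (g : Fin (n+1) → G) : DD (i+1) c (insT k g) = DD i (SS k c) g := by
  unfold DD SS
  congr 1
  · simp only [scalT, ext_insT, insN]
    grind
  · congr 1
    apply tup_ext
    intro l hl
    simp only [ext_faceT, ext_insT, faceN, insN]
    grind

theorem PtAt_SS {G M : Type*} [Group G] [AddCommGroup M] {n : ℕ}
    (c : (Fin (n+1) → G) → M) (j k : ℕ) (hj : j < k) (h : PtAt j c) : PtAt j (SS k c) := by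
  intro g hj' hg
  apply h _ (by omega)
  simp only [ext_insT, insN]
  grind

theorem ins_del {G : Type*} [Group G] {n : ℕ} (k : ℕ) (f : Fin (n+1) → G) (hk : k ≤ n)
    (hf : extT f k = 1) : insT k (delT k f) = f := by
  apply tup_ext
  intro l hl
  simp only [ext_insT, ext_delT, insN, delN]
  grind

theorem gdiff_SS {G M : Type*} [Group G] [AddCommGroup M] [DistribMulAction G M] {n : ℕ}
    (c : (Fin (n+1) → G) → M) (k : ℕ) (hk : k ≤ n) (hc : ∀ j < k, PtAt j c)
    (hb : IsCptPointed (gdiff c)) (g : Fin (n+1) → G) :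
    gdiff (SS k c) g = ∑ i ∈ Finset.range (k+1), ((-1:ℤ)^i) • DD i (SS k c) g := by
  have e1 : extT (insT k g) k = 1 := by
    simp only [ext_insT, insN]
    grind
  have h0 : gdiff c (insT k g) = 0 := by
    refine hb _ ⟨⟨k, by omega⟩, ?_⟩
    rw [extT_fin (insT k g)]
    exact e1
  rw [gdiff_eq, ← Finset.sum_range_add_sum_Ico _ (show k + 2 ≤ n + 1 + 2 by omega),
    Finset.sum_range_succ, Finset.sum_range_succ, Finset.sum_eq_zero, zero_add,
    DD_eq c k k (Or.inl rfl) (by omega) _ e1, DD_eq c (k+1) k (Or.inr rfl) (by omega) _ e1,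
    ← add_smul, show (-1:ℤ)^k + (-1)^(k+1) = 0 by ring, zero_smul, zero_add] at h0
  · rw [gdiff_eq, ← Finset.sum_range_add_sum_Ico _ (show k + 1 ≤ n + 2 by omega)]
    rw [add_eq_left, ← neg_eq_zero, ← h0, ← Finset.sum_Ico_add' _ (k+1) (n+2) 1,
      ← Finset.sum_neg_distrib]
    refine Finset.sum_congr rfl fun i hi => ?_
    rw [Finset.mem_Ico] at hi
    rw [DD_ins c i k (by omega) (by omega), ← neg_smul, pow_succ]
    simp
  · intro i hi
    rw [Finset.mem_range] at hi
    rw [DD_lt c i k hi (hc _ (by omega)) _ (by omega) e1, smul_zero]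

theorem step {G M : Type*} [Group G] [AddCommGroup M] [DistribMulAction G M] {n : ℕ}
    (c : (Fin (n+1) → G) → M) (k : ℕ) (hk : k ≤ n) (hc : ∀ j < k, PtAt j c)
    (hb : IsCptPointed (gdiff c)) :
    ∀ j < k + 1, PtAt j (fun g => c g - ((-1:ℤ)^k) • gdiff (SS k c) g) := by
  intro j hj f hjn hf
  simp only
  have hS : ∀ j < k, PtAt j (SS k c) := fun j hj => PtAt_SS c j k hj (hc j hj)
  rw [gdiff_SS c k hk hc hb]
  rcases Nat.lt_succ_iff_lt_or_eq.mp hj with hj | rfl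
  · rw [hc j hj f hjn hf, Finset.sum_eq_add (a := j) (b := j+1) (by omega),
      DD_eq _ j j (Or.inl rfl) (by omega) _ hf, DD_eq _ (j+1) j (Or.inr rfl) (by omega) _ hf,
      ← add_smul, show (-1:ℤ)^j + (-1)^(j+1) = 0 by ring, zero_smul, smul_zero, sub_zero]
    · intro i hi hne
      rw [Finset.mem_range] at hi
      rcases lt_or_ge i j with h | h
      · rw [DD_lt _ i j h (hS _ (by omega)) _ (by omega) hf, smul_zero]
      · rw [DD_gt _ i j (by omega) (by omega) (hS _ hj) _ (by omega) hf, smul_zero]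
    · intro h; exact absurd (Finset.mem_range.2 (by omega)) h
    · intro h; exact absurd (Finset.mem_range.2 (by omega)) h
  · rw [Finset.sum_range_succ, Finset.sum_eq_zero, zero_add,
      DD_eq _ j j (Or.inl rfl) (by omega) _ hf, smul_smul, ← mul_pow]
    · simp [SS, ins_del j f hk hf]
    · intro i hi
      rw [Finset.mem_range] at hi
      rw [DD_lt _ i j hi (hS _ (by omega)) _ (by omega) hf, smul_zero]

theorem gdiff_pointed {G M : Type*} [Group G] [AddCommGroup M] [DistribMulAction G M] {n : ℕ}
    (c : (Fin n → G) → M) (hc : IsCptPointed c) : IsCptPointed (gdiff c) := by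
  have hP : ∀ j, PtAt j c := fun j f hj hf => hc f ⟨⟨j, hj⟩, by rw [extT_fin f]; exact hf⟩
  rintro f ⟨⟨j, hjn⟩, hf⟩
  rw [extT_fin f] at hf
  simp only at hf
  rw [gdiff_eq, Finset.sum_eq_add (a := j) (b := j+1) (by omega),
      DD_eq _ j j (Or.inl rfl) (by omega) _ hf, DD_eq _ (j+1) j (Or.inr rfl) (by omega) _ hf,
      ← add_smul, show (-1:ℤ)^j + (-1)^(j+1) = 0 by ring, zero_smul]
  · intro i hi hne
    rw [Finset.mem_range] at hi
    rcases lt_or_ge i j with h | h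
    · rw [DD_lt _ i j h (hP _) _ (by omega) hf, smul_zero]
    · rw [DD_gt _ i j (by omega) (by omega) (hP _) _ (by omega) hf, smul_zero]
  · intro h; exact absurd (Finset.mem_range.2 (by omega)) h
  · intro h; exact absurd (Finset.mem_range.2 (by omega)) h

theorem iter {G M : Type*} [Group G] [AddCommGroup M] [DistribMulAction G M] {n : ℕ}
    (c : (Fin (n+1) → G) → M) (hb : IsCptPointed (gdiff c)) (k : ℕ) (hk : k ≤ n + 1) :
    ∃ c' : (Fin (n+1) → G) → M, gdiff c' = gdiff c ∧ ∀ j < k, PtAt j c' := by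
  induction k with
  | zero => exact ⟨c, rfl, by simp⟩
  | succ k ih =>
    obtain ⟨c', h1, h2⟩ := ih (by omega)
    refine ⟨_, ?_, step c' k (by omega) h2 (h1 ▸ hb)⟩
    funext f
    rw [gdiff_sub_smul, gdiff_gdiff, h1]
    simp

/-- For `n = m + 1 ≥ 1`, every componentwise pointed `n`-coboundary is the differential
of a componentwise pointed `(n−1)`-cochain: `B^n_cpt(G,M) = (C^{n−1}_cpt(G,M))∂`. -/
theorem cptCoboundary_eq_gdiff_cpt {G M : Type*} [Group G] [AddCommGroup M]
    [DistribMulAction G M] (m : ℕ) (b : (Fin (m + 1) → G) → M) :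
    ((∃ c : (Fin m → G) → M, gdiff c = b) ∧ IsCptPointed b) ↔
      ∃ c : (Fin m → G) → M, IsCptPointed c ∧ gdiff c = b := by
  constructor
  · rintro ⟨⟨c, rfl⟩, hb⟩
    cases m with
    | zero => exact ⟨c, fun f ⟨j, _⟩ => j.elim0, rfl⟩
    | succ n =>
      obtain ⟨c', h1, h2⟩ := iter c hb (n+1) le_rfl
      refine ⟨c', ?_, h1⟩
      rintro f ⟨j, hj⟩
      exact h2 j.1 j.2 f j.2 (by rw [← extT_fin f]; exact hj)
  · rintro ⟨c, hc, rfl⟩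
    exact ⟨⟨c, rfl⟩, gdiff_pointed c hc⟩
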